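/- Let G be a finite multigraph with n vertices and n−1 edges and a distinguished vertex r. Then the number of orientations of G in which every vertex other than r has out-degree exactly 1 is either 0, or 2^k where k is the number of connected components of G not containing r; moreover this number is nonzero if and only if the component containing r is a tree and every other component contains exactly one cycle. -/

import Mathlib

/-- Two points are related when their forward orbits under `f` meet. -/
def OrbRel {V : Type} (f : V → V) (x y : V) : Prop := ∃ m n : ℕ, f^[m] x = f^[n] y

lemma OrbRel.rfl' {V : Type} (f : V → V) (x : V) : OrbRel f x x := ⟨0, 0, rfl⟩

lemma OrbRel.symm' {V : Type} {f : V → V} {x y : V} (h : OrbRel f x y) : OrbRel f y x := by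
  obtain ⟨m, n, h⟩ := h
  exact ⟨n, m, h.symm⟩

lemma OrbRel.trans' {V : Type} {f : V → V} {x y z : V} (h : OrbRel f x y) (h' : OrbRel f y z) :
    OrbRel f x z := by
  obtain ⟨m, n, h⟩ := h
  obtain ⟨a, b, h'⟩ := h'
  refine ⟨a + m, n + b, ?_⟩
  rw [Function.iterate_add_apply, h, Function.iterate_add_apply, ← h',
    ← Function.iterate_add_apply, ← Function.iterate_add_apply, add_comm]

lemma OrbRel.iter {V : Type} (f : V → V) (x : V) (k : ℕ) : OrbRel f x (f^[k] x) := ⟨k, 0, rfl⟩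

lemma exists_iter {V : Type} {f : V → V} {x y : V} (h : OrbRel f x y)
    (hp : ∃ k, 0 < k ∧ f^[k] y = y) : ∃ k, y = f^[k] x := by
  obtain ⟨m, n, h⟩ := h
  obtain ⟨p, hp, hy⟩ := hp
  have h1 : f^[p * n] y = y := by
    rw [Function.iterate_mul]
    exact Function.iterate_fixed hy n
  have hle : n ≤ p * n := Nat.le_mul_of_pos_left n hp
  refine ⟨(p * n - n) + m, ?_⟩
  rw [Function.iterate_add_apply, h, ← Function.iterate_add_apply, Nat.sub_add_cancel hle, h1]

lemma exists_eventual {V : Type} [Finite V] (f : V → V) (x : V) :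
    ∃ i k, 0 < k ∧ f^[i] x = f^[i + k] x := by
  obtain ⟨a, b, hab, h⟩ := Finite.exists_ne_map_eq_of_infinite (fun n : ℕ => f^[n] x)
  rcases lt_or_gt_of_ne hab with hlt | hlt
  · exact ⟨a, b - a, by omega, by rw [Nat.add_sub_cancel' hlt.le]; exact h⟩
  · exact ⟨b, a - b, by omega, by rw [Nat.add_sub_cancel' hlt.le]; exact h.symm⟩

lemma iter_mem {V : Type} {f : V → V} {S : Set V} (hS : f '' S = S) {x : V} (hx : x ∈ S)
    (k : ℕ) : f^[k] x ∈ S := by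
  have hm : Set.MapsTo f S S := fun y hy => hS ▸ Set.mem_image_of_mem f hy
  exact hm.iterate k hx

lemma injOn_of_image {V : Type} [Finite V] {f : V → V} {S : Set V} (hS : f '' S = S) :
    Set.InjOn f S := by
  exact Set.injOn_of_ncard_image_eq (by rw [hS]) (Set.toFinite S)

lemma periodic_of_mem {V : Type} [Finite V] {f : V → V} {S : Set V} (hS : f '' S = S) {x : V}
    (hx : x ∈ S) : ∃ k, 0 < k ∧ f^[k] x = x := by
  have hm : Set.MapsTo f S S := fun y hy => hS ▸ Set.mem_image_of_mem f hy
  obtain ⟨i, k, hk, h⟩ := exists_eventual f x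
  refine ⟨k, hk, ?_⟩
  rw [Function.iterate_add_apply] at h
  exact ((injOn_of_image hS).iterate hm i hx (iter_mem hS hx k) h).symm

lemma card_invariant {V : Type} [Finite V] (f : V → V) (r : V) (hr : f r = r) :
    Nat.card {S : Set V // r ∉ S ∧ f '' S = S} =
      2 ^ Set.ncard {C : Set V | (∃ v, C = {w | OrbRel f v w}) ∧ r ∉ C} := by
  classical
  let K := {C : Set V | (∃ v, C = {w | OrbRel f v w}) ∧ r ∉ C}
  have h2 : Nat.card (Set K) = 2 ^ Set.ncard K := by
    have := Fintype.ofFinite K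
    rw [Nat.card_eq_fintype_card, Fintype.card_set, ← Nat.card_eq_fintype_card,
      Nat.card_coe_set_eq]
  rw [← h2]
  let Φ : {S : Set V // r ∉ S ∧ f '' S = S} → Set K := fun S => {C | ∃ x ∈ S.1, x ∈ C.1}
  have key : ∀ S S' : {S : Set V // r ∉ S ∧ f '' S = S}, Φ S = Φ S' → S.1 ⊆ S'.1 := by
    rintro ⟨S, hrS, hS⟩ ⟨S', hrS', hS'⟩ h x hx
    have hx' : x ∈ S := hx
    have hrC : r ∉ {w | OrbRel f x w} := by
      intro hxr
      obtain ⟨k, hk⟩ := exists_iter hxr ⟨1, one_pos, hr⟩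
      exact hrS (hk ▸ iter_mem hS hx' k)
    let C : K := ⟨{w | OrbRel f x w}, ⟨x, rfl⟩, hrC⟩
    have hC : C ∈ Φ ⟨S, hrS, hS⟩ := ⟨x, hx', OrbRel.rfl' f x⟩
    rw [h] at hC
    obtain ⟨y, hy, hxy⟩ := hC
    have hyx : OrbRel f x y := hxy
    obtain ⟨k, hk⟩ := exists_iter hyx.symm' (periodic_of_mem hS hx')
    rw [hk]
    exact iter_mem hS' hy k
  apply Nat.card_eq_of_bijective Φ
  constructor
  · intro S S' h
    exact Subtype.ext (Set.Subset.antisymm (key S S' h) (key S' S h.symm))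
  · intro T
    let S : Set V := {x | (∃ k, 0 < k ∧ f^[k] x = x) ∧ ∃ C ∈ T, x ∈ C.1}
    have hclosed : ∀ C : K, ∀ x y, x ∈ C.1 → OrbRel f x y → y ∈ C.1 := by
      rintro ⟨C, ⟨v, rfl⟩, hC⟩ x y hx hxy
      exact OrbRel.trans' hx hxy
    have hrS : r ∉ S := by
      rintro ⟨-, C, -, hC⟩
      exact C.2.2 hC
    have hS : f '' S = S := by
      ext x
      constructor
      · rintro ⟨y, ⟨⟨k, hk, hy⟩, C, hCT, hyC⟩, rfl⟩
        refine ⟨⟨k, hk, ?_⟩, C, hCT, hclosed C _ _ hyC (OrbRel.iter f y 1)⟩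
        rw [← Function.iterate_succ_apply f k y, Function.iterate_succ_apply', hy]
      · rintro ⟨⟨k, hk, hx⟩, C, hCT, hxC⟩
        obtain ⟨j, rfl⟩ : ∃ j, k = j + 1 := ⟨k - 1, by omega⟩
        refine ⟨f^[j] x, ⟨⟨j + 1, hk, ?_⟩, C, hCT, hclosed C _ _ hxC (OrbRel.iter f x j)⟩, ?_⟩
        · rw [← Function.iterate_add_apply, add_comm, Function.iterate_add_apply, hx]
        · exact (Function.iterate_succ_apply' f j x).symm.trans hx
    refine ⟨⟨S, hrS, hS⟩, ?_⟩
    ext C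
    constructor
    · rintro ⟨x, ⟨-, C', hC'T, hxC'⟩, hxC⟩
      have : C = C' := by
        apply Subtype.ext
        obtain ⟨C, ⟨v, rfl⟩, hC⟩ := C
        obtain ⟨C', ⟨v', rfl⟩, hC'⟩ := C'
        have hx1 : OrbRel f v x := hxC
        have hx2 : OrbRel f v' x := hxC'
        ext w
        exact ⟨fun hw => (hx2.trans' hx1.symm').trans' hw,
          fun hw => (hx1.trans' hx2.symm').trans' hw⟩
      rw [this]; exact hC'T
    · intro hCT
      obtain ⟨v, hv⟩ := C.2.1
      obtain ⟨i, k, hk, h⟩ := exists_eventual f v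
      have hvC : v ∈ C.1 := by rw [hv]; exact OrbRel.rfl' f v
      have hmem := hclosed C _ _ hvC (OrbRel.iter f v i)
      refine ⟨f^[i] v, ⟨⟨k, hk, ?_⟩, C, hCT, hmem⟩, hmem⟩
      rw [← Function.iterate_add_apply, add_comm, ← h]

/-- adjacency in the multigraph -/
def MAdj {V E : Type} (ends : E → V × V) : V → V → Prop :=
  fun x y : V => ∃ e, ends e = (x, y) ∨ ends e = (y, x)

lemma MAdj.symm' {V E : Type} {ends : E → V × V} {x y : V} (h : MAdj ends x y) :
    MAdj ends y x := by
  obtain ⟨e, h⟩ := h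
  exact ⟨e, h.symm⟩

lemma reach_symm {V E : Type} {ends : E → V × V} {x y : V}
    (h : Relation.ReflTransGen (MAdj ends) x y) : Relation.ReflTransGen (MAdj ends) y x := by
  induction h with
  | refl => exact .refl
  | tail _ h2 ih => exact Relation.ReflTransGen.head (MAdj.symm' h2) ih

lemma reach_ends {V E : Type} (ends : E → V × V) (e : E) :
    Relation.ReflTransGen (MAdj ends) (ends e).1 (ends e).2 :=
  Relation.ReflTransGen.single ⟨e, Or.inl rfl⟩

open Classical in
lemma hall_cond {V E : Type} [Fintype V] [Fintype E] (ends : E → V × V) (r : V)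
    (h : ∀ v : V, r ∉ {w | Relation.ReflTransGen (MAdj ends) v w} →
         Nat.card {e : E // (ends e).1 ∈ {w | Relation.ReflTransGen (MAdj ends) v w}}
          = Nat.card {w | Relation.ReflTransGen (MAdj ends) v w}) :
    ∀ (n : ℕ) (W : Finset V), W.card = n → r ∉ W →
      W.card ≤ (Finset.univ.filter (fun e => (ends e).1 ∈ W ∨ (ends e).2 ∈ W)).card := by
  intro n
  induction n using Nat.strong_induction_on with
  | _ n ih =>
  intro W hWn hrW
  by_cases hc : ∃ w ∈ W, ∃ u, u ∉ W ∧ MAdj ends w u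
  · obtain ⟨w, hw, u, hu, e, he⟩ := hc
    have hcard := Finset.card_erase_add_one hw
    have := ih (W.erase w).card (by omega) (W.erase w) rfl (fun hh => hrW (Finset.mem_of_mem_erase hh))
    have hlt : (Finset.univ.filter (fun e => (ends e).1 ∈ W.erase w ∨ (ends e).2 ∈ W.erase w)).card
        < (Finset.univ.filter (fun e => (ends e).1 ∈ W ∨ (ends e).2 ∈ W)).card := by
      apply Finset.card_lt_card
      rw [Finset.ssubset_iff_of_subset]
      · refine ⟨e, ?_, ?_⟩
        · rcases he with he | he <;> simp [he, hw]
        · rcases he with he | he <;> simp [he, hu]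
      · intro e' he'
        simp only [Finset.mem_filter, Finset.mem_univ, true_and, Finset.mem_erase] at he' ⊢
        tauto
    omega
  · push Not at hc
    have hcl : ∀ w ∈ W, ∀ u, MAdj ends w u → u ∈ W := by
      intro w hw u hwu
      by_contra hu
      exact hc w hw u hu hwu
    rcases W.eq_empty_or_nonempty with rfl | ⟨v, hv⟩
    · simp
    have hreach : ∀ w, Relation.ReflTransGen (MAdj ends) v w → w ∈ W := by
      intro w hw
      induction hw with
      | refl => exact hv
      | tail _ h2 ih => exact hcl _ ih _ h2
    let C : Finset V := Finset.univ.filter (fun w => Relation.ReflTransGen (MAdj ends) v w)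
    have hmemC : ∀ w, w ∈ C ↔ Relation.ReflTransGen (MAdj ends) v w := by simp [C]
    have hCW : C ⊆ W := fun w hw => hreach w ((hmemC w).1 hw)
    have hvC : v ∈ C := (hmemC v).2 .refl
    have hCe := h v (fun hh => hrW (hreach r hh))
    have e1 : Nat.card {w | Relation.ReflTransGen (MAdj ends) v w} = C.card := by
      rw [Nat.card_coe_set_eq, ← Set.ncard_coe_finset]
      congr 1; ext w; simp [C]
    have e2 : Nat.card {e : E // (ends e).1 ∈ {w | Relation.ReflTransGen (MAdj ends) v w}}
        = (Finset.univ.filter (fun e => (ends e).1 ∈ C)).card := by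
      rw [Nat.card_eq_fintype_card, Fintype.card_subtype]
      congr 1; ext e; simp [C]
    rw [e1, e2] at hCe
    have hsd := Finset.card_sdiff_add_card_eq_card hCW
    have hpos : 0 < C.card := Finset.card_pos.2 ⟨v, hvC⟩
    have := ih (W \ C).card (by omega) (W \ C) rfl
      (fun hh => hrW (Finset.mem_sdiff.1 hh).1)
    have hends : ∀ e, (ends e).1 ∈ C ↔ (ends e).2 ∈ C := by
      intro e
      rw [hmemC, hmemC]
      exact ⟨fun h => h.trans (reach_ends ends e), fun h => h.trans (reach_symm (reach_ends ends e))⟩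
    have hdis : Disjoint
        (Finset.univ.filter (fun e => (ends e).1 ∈ W \ C ∨ (ends e).2 ∈ W \ C))
        (Finset.univ.filter (fun e => (ends e).1 ∈ C)) := by
      rw [Finset.disjoint_left]
      intro e he he'
      simp only [Finset.mem_filter, Finset.mem_univ, true_and, Finset.mem_sdiff] at he he'
      have := hends e
      tauto
    have hsub : (Finset.univ.filter (fun e => (ends e).1 ∈ W \ C ∨ (ends e).2 ∈ W \ C)) ∪
        (Finset.univ.filter (fun e => (ends e).1 ∈ C)) ⊆
        (Finset.univ.filter (fun e => (ends e).1 ∈ W ∨ (ends e).2 ∈ W)) := by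
      intro e he
      simp only [Finset.mem_union, Finset.mem_filter, Finset.mem_univ, true_and,
        Finset.mem_sdiff] at he ⊢
      have := @hCW (ends e).1
      tauto
    have h3 := Finset.card_le_card hsub
    rw [Finset.card_union_of_disjoint hdis] at h3
    omega

/-- tail of an edge -/
def mtail {V E : Type} (ends : E → V × V) (σ : E → Bool) (e : E) : V :=
  if σ e then (ends e).1 else (ends e).2

/-- head of an edge -/
def mhead {V E : Type} (ends : E → V × V) (σ : E → Bool) (e : E) : V :=
  if σ e then (ends e).2 else (ends e).1

/-- good orientations -/
def MGood {V E : Type} (ends : E → V × V) (r : V) (σ : E → Bool) : Prop :=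
  ∀ v : V, v ≠ r → Nat.card {e : E // mtail ends σ e = v} = 1

/-- Reformulation of goodness. -/
lemma good_iff {V E : Type} [Fintype V] [Fintype E] (ends : E → V × V) (r : V)
    (hcard : Fintype.card E + 1 = Fintype.card V) (σ : E → Bool) :
    MGood ends r σ ↔ (∀ e, mtail ends σ e ≠ r) ∧ ∀ v, v ≠ r → ∃ e, mtail ends σ e = v := by
  classical
  have hc : Fintype.card {v : V // v ≠ r} = Fintype.card E := by
    rw [Fintype.card_subtype_compl, Fintype.card_subtype_eq]; omega
  constructor
  · intro h
    have hex : ∀ v, v ≠ r → ∃ e, mtail ends σ e = v := by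
      intro v hv
      have h1 := h v hv
      rw [Nat.card_eq_one_iff_exists] at h1
      obtain ⟨⟨e, he⟩, -⟩ := h1
      exact ⟨e, he⟩
    refine ⟨?_, hex⟩
    choose p hp using hex
    let q : {v : V // v ≠ r} → E := fun v => p v.1 v.2
    have hq : Function.Injective q := by
      intro v w hvw
      apply Subtype.ext
      rw [← hp v.1 v.2, ← hp w.1 w.2]
      exact congrArg _ hvw
    have hqs : Function.Surjective q :=
      ((Fintype.bijective_iff_injective_and_card q).2 ⟨hq, hc⟩).2
    intro e he
    obtain ⟨v, rfl⟩ := hqs e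
    exact v.2 ((hp v.1 v.2).symm.trans he)
  · rintro ⟨h1, h2⟩ v hv
    let q : E → {v : V // v ≠ r} := fun e => ⟨mtail ends σ e, h1 e⟩
    have hqs : Function.Surjective q := by
      intro w
      obtain ⟨e, he⟩ := h2 w.1 w.2
      exact ⟨e, Subtype.ext he⟩
    have hq : Function.Injective q :=
      ((Fintype.bijective_iff_surjective_and_card q).2 ⟨hqs, hc.symm⟩).1
    rw [Nat.card_eq_one_iff_exists]
    obtain ⟨e, he⟩ := h2 v hv
    refine ⟨⟨e, he⟩, ?_⟩
    rintro ⟨e', he'⟩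
    apply Subtype.ext
    exact hq (Subtype.ext (he'.trans he.symm))

lemma good_inj {V E : Type} [Finite E] (ends : E → V × V) (r : V)
    (σ : E → Bool) (h : MGood ends r σ) (h' : ∀ e, mtail ends σ e ≠ r) :
    Function.Injective (mtail ends σ) := by
  intro e e' hee
  have h1 := h (mtail ends σ e') (h' e')
  rw [Nat.card_eq_one_iff_unique] at h1
  have := h1.1.elim ⟨e, hee⟩ ⟨e', rfl⟩
  exact congrArg Subtype.val this

lemma exists_good {V E : Type} [Fintype V] [Fintype E] (ends : E → V × V) (r : V)
    (hcard : Fintype.card E + 1 = Fintype.card V)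
    (h : ∀ v : V, r ∉ {w | Relation.ReflTransGen (MAdj ends) v w} →
         Nat.card {e : E // (ends e).1 ∈ {w | Relation.ReflTransGen (MAdj ends) v w}}
          = Nat.card {w | Relation.ReflTransGen (MAdj ends) v w}) :
    ∃ σ, MGood ends r σ := by
  classical
  have hc : Fintype.card {v : V // v ≠ r} = Fintype.card E := by
    rw [Fintype.card_subtype_compl, Fintype.card_subtype_eq]; omega
  let t : {v : V // v ≠ r} → Finset E := fun v =>
    Finset.univ.filter (fun e => (ends e).1 = v.1 ∨ (ends e).2 = v.1)
  obtain ⟨q, hq, hqt⟩ := (Finset.all_card_le_biUnion_card_iff_exists_injective t).1 (by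
    intro s
    have := hall_cond ends r h _ (s.map (Function.Embedding.subtype _)) rfl (by simp)
    rw [Finset.card_map] at this
    refine this.trans (Finset.card_le_card ?_)
    intro e he
    simp only [Finset.mem_filter, Finset.mem_univ, true_and, Finset.mem_map,
      Function.Embedding.subtype_apply] at he
    simp only [Finset.mem_biUnion, t, Finset.mem_filter, Finset.mem_univ, true_and]
    rcases he with ⟨a, ha, hae⟩ | ⟨a, ha, hae⟩
    · exact ⟨a, ha, Or.inl hae.symm⟩
    · exact ⟨a, ha, Or.inr hae.symm⟩)
  have hqb : Function.Bijective q := (Fintype.bijective_iff_injective_and_card q).2 ⟨hq, hc⟩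
  let g := (Equiv.ofBijective q hqb).symm
  have hg : ∀ v, g (q v) = v := fun v => (Equiv.ofBijective q hqb).symm_apply_apply v
  let σ : E → Bool := fun e => decide ((ends e).1 = (g e).1)
  have ht : ∀ v, mtail ends σ (q v) = v.1 := by
    intro v
    have h1 := hqt v
    simp only [t, Finset.mem_filter, Finset.mem_univ, true_and] at h1
    simp only [mtail, σ, hg, decide_eq_true_eq]
    split_ifs with h2
    · exact h2
    · tauto
  refine ⟨σ, (good_iff ends r hcard σ).2 ⟨?_, ?_⟩⟩
  · intro e
    obtain ⟨v, rfl⟩ := hqb.2 e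
    rw [ht]; exact v.2
  · intro v hv
    exact ⟨q ⟨v, hv⟩, ht _⟩

lemma mtail_reach {V E : Type} (ends : E → V × V) (σ : E → Bool) (e : E) :
    Relation.ReflTransGen (MAdj ends) (ends e).1 (mtail ends σ e) := by
  unfold mtail
  split_ifs
  · exact .refl
  · exact reach_ends ends e

/-- edges of a component versus non-root vertices of it -/
lemma comp_card {V E : Type} [Fintype V] [Fintype E] (ends : E → V × V) (r : V)
    (hcard : Fintype.card E + 1 = Fintype.card V) (σ : E → Bool) (hσ : MGood ends r σ) (v : V) :
    Nat.card {e : E // (ends e).1 ∈ {w | Relation.ReflTransGen (MAdj ends) v w}} =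
      Set.ncard ({w | Relation.ReflTransGen (MAdj ends) v w} \ {r}) := by
  obtain ⟨h1, h2⟩ := (good_iff ends r hcard σ).1 hσ
  have hinj := good_inj ends r σ hσ h1
  rw [← Nat.card_coe_set_eq]
  have hm : ∀ e, (ends e).1 ∈ {w | Relation.ReflTransGen (MAdj ends) v w} ↔
      mtail ends σ e ∈ {w | Relation.ReflTransGen (MAdj ends) v w} := by
    intro e
    have := mtail_reach ends σ e
    exact ⟨fun h => Relation.ReflTransGen.trans h this,
      fun h => Relation.ReflTransGen.trans h (reach_symm this)⟩
  refine Nat.card_eq_of_bijective (fun e => ⟨mtail ends σ e.1, (hm e.1).1 e.2, h1 e.1⟩) ⟨?_, ?_⟩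
  · intro e e' hee
    exact Subtype.ext (hinj (congrArg Subtype.val hee))
  · rintro ⟨w, hw, hwr⟩
    obtain ⟨e, rfl⟩ := h2 w hwr
    exact ⟨⟨e, (hm e).2 hw⟩, rfl⟩

lemma count_good {V E : Type} [Fintype V] [Fintype E] (ends : E → V × V) (r : V)
    (hcard : Fintype.card E + 1 = Fintype.card V) (σ₀ : E → Bool) (h₀ : MGood ends r σ₀) :
    Nat.card {σ : E → Bool // MGood ends r σ} =
      2 ^ Set.ncard {C : Set V |
        (∃ v, C = {w | Relation.ReflTransGen (MAdj ends) v w}) ∧ r ∉ C} := by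
  classical
  obtain ⟨h1, h2⟩ := (good_iff ends r hcard σ₀).1 h₀
  have hinj := good_inj ends r σ₀ h₀ h1
  choose p hp using h2
  let f : V → V := fun v => if hv : v = r then r else mhead ends σ₀ (p v hv)
  have hfr : f r = r := by simp [f]
  have hft : ∀ e, f (mtail ends σ₀ e) = mhead ends σ₀ e := by
    intro e
    have : p (mtail ends σ₀ e) (h1 e) = e := hinj (hp _ _)
    simp only [f, dif_neg (h1 e), this]
  have hedge : ∀ e, OrbRel f (ends e).1 (ends e).2 := by
    intro e
    have h3 : OrbRel f (mtail ends σ₀ e) (mhead ends σ₀ e) := by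
      rw [← hft]; exact OrbRel.iter f _ 1
    unfold mtail mhead at h3
    split_ifs at h3
    · exact h3
    · exact h3.symm'
  have hstep : ∀ v, Relation.ReflTransGen (MAdj ends) v (f v) := by
    intro v
    by_cases hv : v = r
    · rw [hv, hfr]
    · have h3 : v = mtail ends σ₀ (p v hv) := (hp v hv).symm
      rw [h3, hft]
      unfold mtail mhead
      split_ifs
      · exact reach_ends ends _
      · exact reach_symm (reach_ends ends _)
  have hiter : ∀ k v, Relation.ReflTransGen (MAdj ends) v (f^[k] v) := by
    intro k
    induction k with
    | zero => intro v; exact .refl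
    | succ k ih => intro v; rw [Function.iterate_succ_apply']; exact (ih v).trans (hstep _)
  have hreach : ∀ v w, Relation.ReflTransGen (MAdj ends) v w ↔ OrbRel f v w := by
    intro v w
    constructor
    · intro h
      induction h with
      | refl => exact OrbRel.rfl' f v
      | tail _ h4 ih =>
        refine ih.trans' ?_
        obtain ⟨e, he | he⟩ := h4
        · have := hedge e; rw [he] at this; exact this
        · have := hedge e; rw [he] at this; exact this.symm'
    · rintro ⟨m, n, h⟩
      have := hiter m v
      rw [h] at this
      exact this.trans (reach_symm (hiter n w))
  simp only [hreach]
  rw [← card_invariant f r hfr]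
  -- the set of tails of reversed edges
  let S : (E → Bool) → Set V := fun σ => {v | ∃ e, mtail ends σ₀ e = v ∧ σ e ≠ σ₀ e}
  have hSmem : ∀ σ e, mtail ends σ₀ e ∈ S σ ↔ σ e ≠ σ₀ e := by
    intro σ e
    constructor
    · rintro ⟨e', he', h⟩
      rw [hinj he'] at h; exact h
    · intro h; exact ⟨e, rfl, h⟩
  have hrS : ∀ σ, r ∉ S σ := by
    rintro σ ⟨e, he, -⟩
    exact h1 e he
  have htail : ∀ σ e, mtail ends σ e =
      if mtail ends σ₀ e ∈ S σ then f (mtail ends σ₀ e) else mtail ends σ₀ e := by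
    intro σ e
    rw [hft]
    simp only [hSmem]
    unfold mtail mhead
    cases σ e <;> cases σ₀ e <;> simp
  have hgood : ∀ σ, MGood ends r σ ↔ f '' (S σ) = S σ := by
    intro σ
    constructor
    · intro hσ
      obtain ⟨h3, h4⟩ := (good_iff ends r hcard σ).1 hσ
      have hinj' := good_inj ends r σ hσ h3
      have hmaps : Set.MapsTo f (S σ) (S σ) := by
        rintro v ⟨e, rfl, hne⟩
        have hmem := (hSmem σ e).2 hne
        by_contra hf
        have h5 := htail σ e
        rw [if_pos hmem] at h5
        have h6 : f (mtail ends σ₀ e) ≠ r := h5 ▸ h3 e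
        have h7 := htail σ (p _ h6)
        rw [hp, if_neg hf] at h7
        have h8 := hinj' (h7.trans h5.symm)
        have h9 := hp _ h6
        rw [h8] at h9
        rw [← h9] at hf
        exact hf hmem
      have hinjS : Set.InjOn f (S σ) := by
        rintro v ⟨e, rfl, hne⟩ w ⟨e', rfl, hne'⟩ hvw
        have h5 := htail σ e
        have h6 := htail σ e'
        rw [if_pos ((hSmem σ e).2 hne)] at h5
        rw [if_pos ((hSmem σ e').2 hne')] at h6
        rw [hinj' (h5.trans (hvw.trans h6.symm))]
      apply Set.eq_of_subset_of_ncard_le hmaps.image_subset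
      rw [Set.ncard_image_of_injOn hinjS]
    · intro hS
      rw [good_iff ends r hcard]
      constructor
      · intro e he
        rw [htail] at he
        split_ifs at he with hm
        · exact hrS σ (he ▸ hS ▸ Set.mem_image_of_mem f hm)
        · exact h1 e he
      · intro v hv
        by_cases hvS : v ∈ S σ
        · have hv' := hvS
          rw [← hS] at hv'
          obtain ⟨u, hu, rfl⟩ := hv'
          obtain ⟨e, rfl, hne⟩ := id hu
          exact ⟨e, by rw [htail, if_pos hu]⟩
        · exact ⟨p v hv, by rw [htail, hp, if_neg hvS]⟩
  refine Nat.card_eq_of_bijective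
    (fun σ => ⟨S σ.1, hrS σ.1, (hgood σ.1).1 σ.2⟩) ⟨?_, ?_⟩
  · rintro ⟨σ, hσ⟩ ⟨τ, hτ⟩ h
    have hS : S σ = S τ := congrArg Subtype.val h
    apply Subtype.ext
    funext e
    have h3 := hSmem σ e
    have h4 := hSmem τ e
    rw [hS, h4] at h3
    show σ e = τ e
    revert h3
    cases σ e <;> cases τ e <;> cases σ₀ e <;> simp
  · rintro ⟨T, hrT, hT⟩
    let σ : E → Bool := fun e => if mtail ends σ₀ e ∈ T then !(σ₀ e) else σ₀ e
    have hσ : S σ = T := by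
      ext v
      constructor
      · rintro ⟨e, rfl, hne⟩
        by_contra hh
        exact hne (by simp [σ, hh])
      · intro hv
        have hvr : v ≠ r := fun hh => hrT (hh ▸ hv)
        refine ⟨p v hvr, hp v hvr, ?_⟩
        simp [σ, hp, hv]
    exact ⟨⟨σ, (hgood σ).2 (by rw [hσ]; exact hT)⟩, Subtype.ext hσ⟩


/-- For a finite multigraph with `n` vertices and `n − 1` edges and a distinguished
vertex `r`, the number `N` of orientations in which every vertex other than `r` has
out-degree exactly `1` is either `0` or `2 ^ k`, where `k` is the number of connected
components not containing `r`; moreover `N ≠ 0` iff the component of `r` is a tree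
(it has one fewer edge than vertices) and every other component is unicyclic
(it has equally many vertices and edges, hence exactly one cycle). -/
theorem stmt2 (V E : Type) [Fintype V] [Fintype E]
    (ends : E → V × V) (r : V)
    (hcard : Fintype.card E + 1 = Fintype.card V) :
    let Reach := Relation.ReflTransGen
      (fun x y : V => ∃ e, ends e = (x, y) ∨ ends e = (y, x))
    let comp : V → Set V := fun v => {w | Reach v w}
    let tail : (E → Bool) → E → V := fun σ e => if σ e then (ends e).1 else (ends e).2
    let good : (E → Bool) → Prop := fun σ =>
      ∀ v : V, v ≠ r → Nat.card {e : E // tail σ e = v} = 1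
    let N := Nat.card {σ : E → Bool // good σ}
    let numComp := Set.ncard {C : Set V | (∃ v, C = comp v) ∧ r ∉ C}
    (N = 0 ∨ N = 2 ^ numComp) ∧
    (N ≠ 0 ↔
      (Nat.card {e : E // (ends e).1 ∈ comp r} + 1 = Nat.card (comp r) ∧
       ∀ v : V, r ∉ comp v →
         Nat.card {e : E // (ends e).1 ∈ comp v} = Nat.card (comp v))) := by
  intro Reach comp tail good N numComp
  have hN0 : N ≠ 0 ↔ ∃ σ, MGood ends r σ := by
    have : N = Nat.card {σ : E → Bool // MGood ends r σ} := rfl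
    rw [this, Nat.card_ne_zero]
    constructor
    · rintro ⟨⟨σ, hσ⟩, -⟩
      exact ⟨σ, hσ⟩
    · rintro ⟨σ, hσ⟩
      exact ⟨⟨⟨σ, hσ⟩⟩, inferInstance⟩
  refine ⟨?_, ?_⟩
  · by_cases h : N = 0
    · exact Or.inl h
    · obtain ⟨σ, hσ⟩ := hN0.1 h
      exact Or.inr (count_good ends r hcard σ hσ)
  · rw [hN0]
    constructor
    · rintro ⟨σ, hσ⟩
      have hc := comp_card ends r hcard σ hσ
      constructor
      · have h1 := hc r
        have h2 : r ∈ comp r := Relation.ReflTransGen.refl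
        have h3 := Set.ncard_diff_singleton_add_one h2
        rw [Nat.card_coe_set_eq, ← h3]
        exact congrArg (· + 1) h1
      · intro v hv
        rw [Nat.card_coe_set_eq]
        refine (hc v).trans ?_
        exact congrArg Set.ncard (Set.diff_singleton_eq_self hv)
    · rintro ⟨-, h⟩
      exact exists_good ends r hcard h
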